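/- Let H be a real Hilbert space and F ⊆ H a nonempty compact subset. Let (f_n)_{n≥1} ⊆ F be a strong greedy sequence for F, i.e., with V_0 := {0} and V_n := span{f_1, …, f_n}, for every n ≥ 0 one has ‖f_{n+1} − Π_{V_n} f_{n+1}‖ = sup_{f ∈ F} dist(f, V_n). Define σ_n := sup_{f ∈ F} dist(f, V_n). If there exist C > 0 and α > 0 such that the Kolmogorov widths satisfy d_n(F, H) ≤ C n^{−α} for all n ≥ 1, then σ_n ≤ 2^{5α+1} C n^{−α} for all n ≥ 1. -/

import Mathlib

/-- The Kolmogorov `n`-width of a subset `F` of a real Hilbert space `H`. -/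
noncomputable def kolmogorovWidth {H : Type*} [NormedAddCommGroup H]
    [InnerProductSpace ℝ H] (F : Set H) (n : ℕ) : ℝ :=
  sInf {r : ℝ | ∃ V : Submodule ℝ H, FiniteDimensional ℝ V ∧
    Module.finrank ℝ V ≤ n ∧ r = ⨆ f ∈ F, Metric.infDist f (V : Set H)}

open Matrix in
lemma det_sq_le_of_rows {K : ℕ} (X : Matrix (Fin K) (Fin K) ℝ) (c : ℝ) 
    (h : ∀ i, ∑ j, X i j ^ 2 ≤ c) : X.det ^ 2 ≤ c ^ K := by
  rcases Nat.eq_zero_or_pos K with hK | hK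
  · subst hK; simp
  have hps := Matrix.posSemidef_self_mul_conjTranspose X
  set ev := hps.isHermitian.eigenvalues with hev
  have h0 : ∀ i, 0 ≤ ev i := fun i => hps.eigenvalues_nonneg i
  have hdet : X.det ^ 2 = ∏ i, ev i := by
    have := hps.isHermitian.det_eq_prod_eigenvalues
    simp only [Matrix.det_mul, Matrix.det_conjTranspose, star_trivial] at this
    rw [pow_two, this]; rfl
  have htr : ∑ i, ev i ≤ K * c := by
    have := hps.isHermitian.trace_eq_sum_eigenvalues
    have h2 : (X * Xᴴ).trace = ∑ i, ∑ j, X i j ^ 2 := by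
      simp [Matrix.trace, Matrix.mul_apply, pow_two]
    rw [h2] at this
    have h3 : ∑ i, ∑ j, X i j ^ 2 ≤ ∑ i : Fin K, c := Finset.sum_le_sum fun i _ => h i
    simp only [Finset.sum_const, Finset.card_univ, Fintype.card_fin, nsmul_eq_mul] at h3
    refine le_trans (le_of_eq ?_) h3
    rw [this]; rfl
  have hKR : (0:ℝ) < K := by exact_mod_cast hK
  have am := Real.geom_mean_le_arith_mean_weighted Finset.univ (fun _ : Fin K => (1 / K : ℝ)) ev
    (fun _ _ => by positivity) (by simp [hKR.ne']) (fun i _ => h0 i)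
  have h4 : ∑ i, (1 / K : ℝ) * ev i ≤ c := by
    rw [← Finset.mul_sum, one_div, inv_mul_le_iff₀ hKR]; exact htr
  have h5 := pow_le_pow_left₀ (Finset.prod_nonneg fun i _ => Real.rpow_nonneg (h0 i) _) (am.trans h4) K
  rw [← Finset.prod_pow] at h5
  rw [hdet]
  refine le_trans (le_of_eq ?_) h5
  refine Finset.prod_congr rfl fun i _ => ?_
  rw [← Real.rpow_natCast, ← Real.rpow_mul (h0 i)]
  simp [hKR.ne']

lemma bessel_sub {H : Type*} [NormedAddCommGroup H] [InnerProductSpace ℝ H] {ι : Type*} [Fintype ι]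
    (φ : ι → H) (hφ : Orthonormal ℝ φ) (g v : H) (hv : ∀ j, inner ℝ v (φ j) = 0) (r : ℝ)
    (hr : ‖g - v‖ ≤ r) : ∑ j, (inner ℝ g (φ j)) ^ 2 ≤ r ^ 2 := by
  have := hφ.sum_inner_products_le (x := g - v) (s := Finset.univ)
  refine le_trans (le_of_eq ?_) (this.trans (pow_le_pow_left₀ (norm_nonneg _) hr 2))
  refine Finset.sum_congr rfl fun j _ => ?_
  rw [Real.norm_eq_abs, sq_abs, real_inner_comm (g - v), inner_sub_left, hv j, sub_zero]

open Matrix in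
lemma key_det {H : Type*} [NormedAddCommGroup H] [InnerProductSpace ℝ H] (s : ℕ)
    (E : Submodule ℝ H) (b : OrthonormalBasis (Fin (s + s)) ℝ E)
    (W : Submodule ℝ H) [FiniteDimensional ℝ W] (hW : Module.finrank ℝ W ≤ s)
    (g : Fin (s + s) → H) (σ d : ℝ) (hσ : 0 < σ) (hd : 0 < d)
    (h1 : ∀ i, ∃ v, (∀ x ∈ E, inner ℝ v x = 0) ∧ ‖g i - v‖ ≤ σ)
    (h2 : ∀ i, ∃ w ∈ W, ‖g i - w‖ ≤ d) :
    (Matrix.of fun i j => inner ℝ (g i) (b j : H)).det ^ 2 ≤ (2 * σ * d) ^ (s + s) := by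
  have : FiniteDimensional ℝ E := b.toBasis.finiteDimensional_of_finite
  have hfin : Module.finrank ℝ E = s + s := by
    simpa using Module.finrank_eq_card_basis b.toBasis
  -- the part of E orthogonal to W
  let T : E →ₗ[ℝ] W := (W.orthogonalProjectionOnto : H →ₗ[ℝ] W) ∘ₗ E.subtype
  have hker : s ≤ Module.finrank ℝ (LinearMap.ker T) := by
    have e1 := T.finrank_range_add_finrank_ker
    have e2 : Module.finrank ℝ (LinearMap.range T) ≤ Module.finrank ℝ W := Submodule.finrank_le _
    omega
  let q := stdOrthonormalBasis ℝ (LinearMap.ker T)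
  let v : Fin (s + s) → E := Fin.addCases (fun _ => 0) (fun j => (q (Fin.castLE hker j) : E))
  let S : Set (Fin (s + s)) := Set.range (Fin.natAdd s)
  have hv : Orthonormal ℝ (S.domRestrict v) := by
    have hq : Orthonormal ℝ (fun j : Fin s => (q (Fin.castLE hker j) : E)) := by
      have := (q.orthonormal.comp (Fin.castLE hker) (Fin.castLE_injective hker))
      exact this.comp_linearIsometry (LinearMap.ker T).subtypeₗᵢ
    rw [orthonormal_iff_ite] at hq ⊢
    rintro ⟨_, i, rfl⟩ ⟨_, j, rfl⟩
    have hiff : ((⟨Fin.natAdd s i, ⟨i, rfl⟩⟩ : S) = ⟨Fin.natAdd s j, ⟨j, rfl⟩⟩) ↔ i = j :=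
      ⟨fun h => Fin.natAdd_injective s s (congrArg Subtype.val h), fun h => by subst h; rfl⟩
    simp only [v, Set.domRestrict_apply, Fin.addCases_right]
    rw [hq i j]
    simp only [hiff]
  obtain ⟨φ, hφ⟩ := hv.exists_orthonormalBasis_extension_of_card_eq (by simpa using hfin)
  have hφW : ∀ j : Fin s, ∀ w ∈ W, inner ℝ w (φ (Fin.natAdd s j) : H) = 0 := by
    intro j w hw
    rw [hφ _ ⟨j, rfl⟩]
    have hm : T (q (Fin.castLE hker j) : E) = 0 := (q (Fin.castLE hker j)).2
    simp only [v, Fin.addCases_right]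
    have := W.inner_orthogonalProjectionOnto_eq_of_mem_left ⟨w, hw⟩ ((q (Fin.castLE hker j) : E) : H)
    rw [← this]
    have hm' : W.orthogonalProjectionOnto ((q (Fin.castLE hker j) : E) : H) = 0 := hm
    rw [hm', inner_zero_right]
  have hφo : Orthonormal ℝ (fun j => (φ j : H)) := φ.orthonormal.comp_linearIsometry E.subtypeₗᵢ
  set A : Matrix (Fin (s+s)) (Fin (s+s)) ℝ := Matrix.of fun i j => inner ℝ (g i) (b j : H) with hA
  let B : Matrix (Fin (s+s)) (Fin (s+s)) ℝ := Matrix.of fun i j => inner ℝ (g i) (φ j : H)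
  have hgram : ∀ c : OrthonormalBasis (Fin (s + s)) ℝ E,
      (Matrix.of fun i j => inner ℝ (g i) (c j : H)) * (Matrix.of fun i j => inner ℝ (g i) (c j : H))ᵀ
      = Matrix.of fun i k => inner ℝ (E.orthogonalProjectionOnto (g i)) (E.orthogonalProjectionOnto (g k)) := by
    intro c
    ext i k
    simp only [Matrix.mul_apply, Matrix.of_apply, Matrix.transpose_apply]
    rw [← c.sum_inner_mul_inner]
    refine Finset.sum_congr rfl fun j _ => ?_
    rw [E.inner_orthogonalProjectionOnto_eq_of_mem_right, E.inner_orthogonalProjectionOnto_eq_of_mem_left,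
      real_inner_comm (g k)]
  have hAB : A.det ^ 2 = B.det ^ 2 := by
    have : (A * Aᵀ).det = (B * Bᵀ).det := by rw [hgram b, hgram φ]
    simpa [Matrix.det_mul, pow_two] using this
  let D : Fin (s + s) → ℝ := Fin.addCases (fun _ => σ⁻¹) (fun _ => d⁻¹)
  have hD : (∏ j, D j) = (σ * d)⁻¹ ^ s := by
    rw [Fin.prod_univ_add]
    simp only [D, Fin.addCases_left, Fin.addCases_right, Finset.prod_const, Finset.card_univ,
      Fintype.card_fin, mul_inv, mul_pow]
  let X : Matrix (Fin (s+s)) (Fin (s+s)) ℝ := B * Matrix.diagonal D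
  have hX : X.det = B.det * (σ * d)⁻¹ ^ s := by
    simp [X, hD]
  have hrow : ∀ i, ∑ j, X i j ^ 2 ≤ 2 := by
    intro i
    obtain ⟨v, hvE, hv⟩ := h1 i
    obtain ⟨w, hwW, hw⟩ := h2 i
    have b1 := bessel_sub (fun j : Fin s => (φ (Fin.castAdd s j) : H))
      (hφo.comp _ (Fin.castAdd_injective s s)) (g i) v (fun j => hvE _ (φ _).2) σ hv
    have b2 := bessel_sub (fun j : Fin s => (φ (Fin.natAdd s j) : H))
      (hφo.comp _ (Fin.natAdd_injective s s)) (g i) w (fun j => hφW j w hwW) d hw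
    rw [Fin.sum_univ_add]
    simp only [X, Matrix.mul_diagonal, D, Fin.addCases_left, Fin.addCases_right, mul_pow,
      ← Finset.sum_mul, B, Matrix.of_apply]
    have c1 : σ ^ 2 * σ⁻¹ ^ 2 = 1 := by field_simp
    have c2 : d ^ 2 * d⁻¹ ^ 2 = 1 := by field_simp
    have := mul_le_mul_of_nonneg_right b1 (sq_nonneg σ⁻¹)
    have := mul_le_mul_of_nonneg_right b2 (sq_nonneg d⁻¹)
    linarith
  have hfinal := det_sq_le_of_rows X 2 hrow
  rw [hX, mul_pow, ← pow_mul, mul_comm s 2, two_mul, inv_pow, ← div_eq_mul_inv,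
    div_le_iff₀ (by positivity), ← mul_pow] at hfinal
  rw [hAB, mul_assoc]
  exact hfinal

lemma infDist_eq_residual {H : Type*} [NormedAddCommGroup H] [InnerProductSpace ℝ H]
    (U : Submodule ℝ H) [U.HasOrthogonalProjection] (x : H) :
    Metric.infDist x (U : Set H) = ‖x - U.starProjection x‖ := by
  rw [U.starProjection_minimal, Metric.infDist_eq_iInf]
  simp only [dist_eq_norm]
  rfl

lemma greedy_step {H : Type*} [NormedAddCommGroup H] [InnerProductSpace ℝ H]
    (F : Set H) (f : ℕ → H) (hfF : ∀ n, f n ∈ F) (V : ℕ → Submodule ℝ H)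
    (hV : ∀ n, V n = Submodule.span ℝ (f '' Set.Iio n))
    (hmax : ∀ n, ∀ g ∈ F, Metric.infDist g (V n : Set H) ≤ Metric.infDist (f n) (V n : Set H))
    (N s : ℕ) (hs : 1 ≤ s) (W : Submodule ℝ H) [FiniteDimensional ℝ W]
    (hW : Module.finrank ℝ W ≤ s) (c : ℝ) (hc : 0 < c)
    (hWc : ∀ g ∈ F, Metric.infDist g (W : Set H) < c) :
    Metric.infDist (f (N + (2 * s - 1))) (V (N + (2 * s - 1)) : Set H) ^ 2
      ≤ 2 * Metric.infDist (f N) (V N : Set H) * c ∧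
    (s = 1 → Metric.infDist (f (N + (2 * s - 1))) (V (N + (2 * s - 1)) : Set H) ≤ 2 * c) := by
  have hfd : ∀ n, FiniteDimensional ℝ (V n) := fun n => by
    rw [hV]; exact FiniteDimensional.span_of_finite ℝ ((Set.finite_Iio n).image f)
  have hmono : Monotone V := fun a b hab => by
    rw [hV, hV]; exact Submodule.span_mono (Set.image_mono (Set.Iio_subset_Iio hab))
  have hmem : ∀ a b, a < b → f a ∈ V b := fun a b hab => by
    rw [hV]; exact Submodule.subset_span ⟨a, hab, rfl⟩
  let σ : ℕ → ℝ := fun n => Metric.infDist (f n) (V n : Set H)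
  have hσ0 : ∀ n, 0 ≤ σ n := fun n => Metric.infDist_nonneg
  have hanti : Antitone σ := fun a b hab =>
    (Metric.infDist_le_infDist_of_subset (hmono hab) ⟨0, (V a).zero_mem⟩).trans
      (hmax a _ (hfF b))
  change σ (N + (2 * s - 1)) ^ 2 ≤ 2 * σ N * c ∧ (s = 1 → σ (N + (2 * s - 1)) ≤ 2 * c)
  rcases (hσ0 (N + (2 * s - 1))).eq_or_lt with h0 | hpos
  · rw [← h0]; have := hσ0 N; exact ⟨by simp only [ne_eq, OfNat.ofNat_ne_zero, not_false_eq_true, zero_pow]; positivity, fun _ => by positivity⟩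
  let r : ℕ → H := fun n => f n - (V n).starProjection (f n)
  have hr : ∀ n, ‖r n‖ = σ n := fun n => (infDist_eq_residual (V n) (f n)).symm
  have hrV : ∀ n, ∀ x ∈ V n, inner ℝ (r n) x = 0 := fun n x hx =>
    Submodule.starProjection_inner_eq_zero _ _ hx
  have hrm : ∀ a b, a < b → r a ∈ V b := fun a b hab =>
    (V b).sub_mem (hmem a b hab) (hmono hab.le ((V a).starProjection_apply_mem _))
  have hspos : ∀ i : Fin (s + s), 0 < σ (N + i) := fun i =>
    hpos.trans_le (hanti (by omega))
  let e : Fin (s + s) → H := fun i => (σ (N + i))⁻¹ • r (N + i)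
  have he : Orthonormal ℝ e := by
    refine ⟨fun i => ?_, fun i j hij => ?_⟩
    · simp only [e, norm_smul, hr, norm_inv, Real.norm_eq_abs, abs_of_pos (hspos i)]
      exact inv_mul_cancel₀ (hspos i).ne'
    · simp only [e, inner_smul_left, inner_smul_right]
      have : inner ℝ (r (N + i)) (r (N + j)) = 0 := by
        rcases lt_or_gt_of_ne hij with h | h
        · rw [real_inner_comm]; exact hrV _ _ (hrm _ _ (by simpa using h))
        · exact hrV _ _ (hrm _ _ (by simpa using h))
      rw [this]; simp
  let E : Submodule ℝ H := Submodule.span ℝ (Set.range e)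
  let e' : Fin (s + s) → E := fun i => ⟨e i, Submodule.subset_span ⟨i, rfl⟩⟩
  have he' : Orthonormal ℝ e' := orthonormal_span he
  let b : OrthonormalBasis (Fin (s + s)) ℝ E := 
    (Module.Basis.span he.linearIndependent).toOrthonormalBasis (by
      convert! he' using 1
      ext j
      simp [e'])
  have hb : ∀ j, (b j : H) = e j := fun j => by simp [b]
  have hEV : ∀ v ∈ V N, ∀ x ∈ E, inner ℝ v x = 0 := by
    intro v hv x hx
    induction hx using Submodule.span_induction with
    | mem x h =>
      obtain ⟨i, rfl⟩ := h
      simp only [e, inner_smul_right]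
      rw [real_inner_comm, hrV _ _ (hmono (Nat.le_add_right _ _) hv), mul_zero]
    | zero => simp
    | add x y _ _ hx hy => rw [inner_add_right, hx, hy, add_zero]
    | smul a x _ hx => rw [inner_smul_right, hx, mul_zero]
  have hkey := key_det s E b W hW (fun i => f (N + i)) (σ N) c
    (hpos.trans_le (hanti (by omega))) hc
    (fun i => ⟨(V N).starProjection (f (N + i)), hEV _ ((V N).starProjection_apply_mem _), by
      rw [← infDist_eq_residual]; exact hmax _ _ (hfF _)⟩)
    (fun i => by
      obtain ⟨w, hw, hwd⟩ := (Metric.infDist_lt_iff ⟨0, W.zero_mem⟩).1 (hWc _ (hfF (N + i)))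
      exact ⟨w, hw, by rw [← dist_eq_norm]; exact hwd.le⟩)
  have hdet : (Matrix.of fun i j => inner ℝ (f (N + (i : Fin (s + s)))) (b j : H)).det
      = ∏ i : Fin (s + s), σ (N + i) := by
    rw [Matrix.det_of_isLowerTriangular]
    · refine Finset.prod_congr rfl fun i _ => ?_
      simp only [Matrix.of_apply, hb, e, inner_smul_right]
      have h3 : f (N + i) = r (N + i) + (V (N + i)).starProjection (f (N + i)) := by simp [r]
      have h4 : inner ℝ (f (N + i)) (r (N + i)) = σ (N + i) ^ 2 := by
        conv_lhs => rw [h3]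
        rw [inner_add_left, real_inner_self_eq_norm_sq, hr, real_inner_comm,
          hrV _ _ ((V _).starProjection_apply_mem _), add_zero]
      rw [h4]
      have := (hspos i).ne'
      field_simp
    · intro i j hij
      have hij' : i < j := hij
      simp only [Matrix.of_apply, hb, e, inner_smul_right]
      rw [real_inner_comm, hrV _ _ (hmem _ _ (by simpa using hij')), mul_zero]
  rw [hdet, ← Finset.prod_pow] at hkey
  have hlow : (σ (N + (2 * s - 1)) ^ 2) ^ (s + s) ≤ ∏ i : Fin (s + s), σ (N + i) ^ 2 := by
    have : ∏ i : Fin (s + s), σ (N + (2 * s - 1)) ^ 2 = (σ (N + (2 * s - 1)) ^ 2) ^ (s + s) := by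
      simp
    rw [← this]
    refine Finset.prod_le_prod (fun i _ => sq_nonneg _) fun i _ => ?_
    exact pow_le_pow_left₀ hpos.le (hanti (by omega)) 2
  have h2 : 0 ≤ 2 * σ N * c := by have := hσ0 N; positivity
  refine ⟨le_of_pow_le_pow_left₀ (by omega) h2 (hlow.trans hkey), ?_⟩
  rintro rfl
  have hN : 0 < σ N := hpos.trans_le (hanti (by omega))
  have h3 : σ N ^ 2 * σ (N + 1) ^ 2 ≤ (2 * σ N * c) ^ 2 := by
    simpa [Fin.prod_univ_two] using hkey
  have h4 : σ (N + 1) ^ 2 ≤ (2 * c) ^ 2 := by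
    refine le_of_mul_le_mul_left (h3.trans (le_of_eq ?_)) (pow_pos hN 2)
    ring
  exact (sq_le_sq₀ (hσ0 _) (by positivity)).1 h4

lemma le_biSup_infDist {H : Type*} [NormedAddCommGroup H] [InnerProductSpace ℝ H]
    (F : Set H) (hF : IsCompact F) (U : Submodule ℝ H) (g : H) (hg : g ∈ F) :
    Metric.infDist g (U : Set H) ≤ ⨆ g ∈ F, Metric.infDist g (U : Set H) := by
  obtain ⟨R, hR⟩ := hF.isBounded.exists_norm_le
  have hb : BddAbove (Set.range fun g => ⨆ (_ : g ∈ F), Metric.infDist g (U : Set H)) := by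
    refine ⟨max R 0, ?_⟩
    rintro _ ⟨x, rfl⟩
    by_cases hx : x ∈ F
    · simp only [hx, ciSup_unique]
      refine le_max_of_le_left (le_trans ?_ (hR x hx))
      simpa using Metric.infDist_le_dist_of_mem (x := x) (U.zero_mem)
    · simp [hx]
  refine le_trans (le_of_eq ?_) (le_ciSup hb g)
  simp [hg]

/-- Polynomial convergence rate of the strong greedy algorithm
(DeVore–Petrova–Wojtaszczyk, Corollary 3.3, Hilbert space case):
if `F` is a nonempty compact subset of a Hilbert space, `(f_n)` is a strong greedy
sequence for `F` (here `f (n-1)` plays the role of `f_n`, and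
`V n = span{f_1, …, f_n}`), and `d_n(F, H) ≤ C n^{−α}` for all `n ≥ 1`, then
`σ_n := sup_{f ∈ F} dist(f, V_n) ≤ 2^{5α+1} C n^{−α}` for all `n ≥ 1`. -/
theorem strong_greedy_polynomial_rate
    {H : Type*} [NormedAddCommGroup H] [InnerProductSpace ℝ H] [CompleteSpace H]
    (F : Set H) (hne : F.Nonempty) (hF : IsCompact F)
    (f : ℕ → H) (hfF : ∀ n, f n ∈ F)
    (V : ℕ → Submodule ℝ H)
    (hV : ∀ n, V n = Submodule.span ℝ (f '' Set.Iio n))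
    (hgreedy : ∀ n, Metric.infDist (f n) ((V n : Set H))
      = ⨆ g ∈ F, Metric.infDist g ((V n : Set H)))
    (C α : ℝ) (hC : 0 < C) (hα : 0 < α)
    (hd : ∀ n : ℕ, 1 ≤ n → kolmogorovWidth F n ≤ C * (n : ℝ) ^ (-α)) :
    ∀ n : ℕ, 1 ≤ n →
      (⨆ g ∈ F, Metric.infDist g ((V n : Set H)))
        ≤ 2 ^ (5 * α + 1) * C * (n : ℝ) ^ (-α) := by
  have hmax : ∀ n, ∀ g ∈ F, Metric.infDist g (V n : Set H) ≤ Metric.infDist (f n) (V n : Set H) :=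
    fun n g hg => by rw [hgreedy]; exact le_biSup_infDist F hF (V n) g hg
  have hmono : Monotone V := fun a b hab => by
    rw [hV, hV]; exact Submodule.span_mono (Set.image_mono (Set.Iio_subset_Iio hab))
  obtain ⟨σ, hσ⟩ : ∃ σ : ℕ → ℝ, ∀ n, σ n = Metric.infDist (f n) (V n : Set H) := ⟨_, fun _ => rfl⟩
  have hσ0 : ∀ n, 0 ≤ σ n := fun n => by rw [hσ]; exact Metric.infDist_nonneg
  have hanti : Antitone σ := fun a b hab => by
    rw [hσ, hσ]
    exact (Metric.infDist_le_infDist_of_subset (hmono hab) ⟨0, (V a).zero_mem⟩).trans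
      (hmax a _ (hfF b))
  have hstep : ∀ N s : ℕ, 1 ≤ s → σ (N + (2 * s - 1)) ^ 2 ≤ 2 * σ N * (C * (s : ℝ) ^ (-α)) ∧
      (s = 1 → σ (N + (2 * s - 1)) ≤ 2 * (C * (s : ℝ) ^ (-α))) := by
    intro N s hs
    have hs0 : (0 : ℝ) < s := by exact_mod_cast hs
    have hc0 : 0 < C * (s : ℝ) ^ (-α) := by positivity
    have hε : ∀ c, C * (s : ℝ) ^ (-α) < c → σ (N + (2 * s - 1)) ^ 2 ≤ 2 * σ N * c ∧
        (s = 1 → σ (N + (2 * s - 1)) ≤ 2 * c) := by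
      intro c hc
      have hlt := (hd s hs).trans_lt hc
      unfold kolmogorovWidth at hlt
      have hnon : {r : ℝ | ∃ V : Submodule ℝ H, FiniteDimensional ℝ V ∧
          Module.finrank ℝ V ≤ s ∧ r = ⨆ f ∈ F, Metric.infDist f (V : Set H)}.Nonempty :=
        ⟨_, ⊥, inferInstance, by simp, rfl⟩
      obtain ⟨_, ⟨W, hWf, hWr, rfl⟩, hWc⟩ := exists_lt_of_csInf_lt hnon hlt
      rw [hσ, hσ]
      exact greedy_step F f hfF V hV hmax N s hs W hWr c (hc0.trans hc)
        fun g hg => (le_biSup_infDist F hF W g hg).trans_lt hWc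
    have hcont : ∀ a : ℝ, Filter.Tendsto (fun c => a * c)
        (nhdsWithin (C * (s : ℝ) ^ (-α)) (Set.Ioi (C * (s : ℝ) ^ (-α))))
        (nhds (a * (C * (s : ℝ) ^ (-α)))) := fun a =>
      ((continuous_const.mul continuous_id).tendsto _).mono_left nhdsWithin_le_nhds
    exact ⟨ge_of_tendsto (hcont _)
        (Filter.eventually_of_mem self_mem_nhdsWithin fun c hc => (hε c hc).1),
      fun h1 => ge_of_tendsto (hcont _)
        (Filter.eventually_of_mem self_mem_nhdsWithin fun c hc => (hε c hc).2 h1)⟩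
  have main : ∀ n : ℕ, 1 ≤ n → σ n ≤ 2 ^ (5 * α + 1) * C * (n : ℝ) ^ (-α) := by
    intro n
    induction n using Nat.strong_induction_on with
    | _ n ih =>
    intro hn
    have hn0 : (0 : ℝ) < n := by exact_mod_cast hn
    by_cases h4 : n < 4
    · -- small n
      have h1 : σ 1 ≤ 2 * C := by
        simpa using (hstep 0 1 le_rfl).2 rfl
      have hn4 : (n : ℝ) ≤ 4 := by exact_mod_cast h4.le
      have h5 : (2 : ℝ) ≤ 2 ^ (5 * α + 1) * (n : ℝ) ^ (-α) := by
        have h6 : (4 : ℝ) ^ (-α) ≤ (n : ℝ) ^ (-α) :=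
          Real.rpow_le_rpow_of_nonpos hn0 hn4 (by linarith)
        have h7 : (4 : ℝ) ^ (-α) = 2 ^ (-(2 * α)) := by
          rw [show (4 : ℝ) = 2 ^ (2 : ℝ) by norm_num, ← Real.rpow_mul (by norm_num)]
          ring_nf
        calc (2 : ℝ) = 2 ^ (1 : ℝ) := by simp
          _ ≤ 2 ^ (5 * α + 1 + -(2 * α)) :=
            Real.rpow_le_rpow_of_exponent_le (by norm_num) (by linarith)
          _ = 2 ^ (5 * α + 1) * 4 ^ (-α) := by rw [h7, Real.rpow_add (by norm_num)]
          _ ≤ _ := by gcongr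
      calc σ n ≤ σ 1 := hanti hn
        _ ≤ 2 * C := h1
        _ ≤ (2 ^ (5 * α + 1) * (n : ℝ) ^ (-α)) * C := by gcongr
        _ = _ := by ring
    · set s := n / 4 with hs
      have hs1 : 1 ≤ s := by omega
      have hs0 : (0 : ℝ) < s := by exact_mod_cast hs1
      have ih2 := ih (2 * s) (by omega) (by omega)
      have hst := (hstep (2 * s) s hs1).1
      have hle : σ n ≤ σ (2 * s + (2 * s - 1)) := hanti (by omega)
      have hn8 : (n : ℝ) ≤ 8 * s := by exact_mod_cast (by omega : n ≤ 8 * s)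
      have hsα : (0 : ℝ) < (s : ℝ) ^ (-α) := by positivity
      have hnα : (8 : ℝ) ^ (-α) * (s : ℝ) ^ (-α) ≤ (n : ℝ) ^ (-α) := by
        rw [← Real.mul_rpow (by norm_num) hs0.le]
        exact Real.rpow_le_rpow_of_nonpos hn0 hn8 (by linarith)
      push_cast at ih2
      rw [Real.mul_rpow (by norm_num) hs0.le] at ih2
      set p : ℝ := 2 ^ α with hp
      have hp0 : 0 < p := by positivity
      have e1 : (2 : ℝ) ^ (-α) = p⁻¹ := Real.rpow_neg (by norm_num) _
      have e2 : (8 : ℝ) ^ (-α) = (p ^ 3)⁻¹ := by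
        rw [Real.rpow_neg (by norm_num), hp, ← Real.rpow_natCast, ← Real.rpow_mul (by norm_num),
          mul_comm α, Real.rpow_mul (by norm_num)]
        norm_num
      have e3 : (2 : ℝ) ^ (5 * α + 1) = 2 * p ^ 5 := by
        rw [Real.rpow_add (by norm_num), hp, ← Real.rpow_natCast, ← Real.rpow_mul (by norm_num),
          mul_comm α, Real.rpow_one, mul_comm]
        norm_num
      rw [e1, e3] at ih2
      rw [e2] at hnα
      rw [e3]
      set t : ℝ := (s : ℝ) ^ (-α) with ht
      have hbig : σ n ≤ 2 * p ^ 2 * C * t := by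
        have h5 : σ n ^ 2 ≤ (2 * p ^ 2 * C * t) ^ 2 := by
          calc σ n ^ 2 ≤ σ (2 * s + (2 * s - 1)) ^ 2 := pow_le_pow_left₀ (hσ0 n) hle 2
            _ ≤ 2 * σ (2 * s) * (C * t) := hst
            _ ≤ 2 * (2 * p ^ 5 * C * (p⁻¹ * t)) * (C * t) := by gcongr
            _ = (2 * p ^ 2 * C * t) ^ 2 := by field_simp
        exact (sq_le_sq₀ (hσ0 _) (by positivity)).1 h5
      calc σ n ≤ 2 * p ^ 2 * C * t := hbig
        _ = 2 * p ^ 5 * C * ((p ^ 3)⁻¹ * t) := by field_simp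
        _ ≤ 2 * p ^ 5 * C * (n : ℝ) ^ (-α) := by gcongr
  intro n hn
  rw [← hgreedy, ← hσ]
  exact main n hn
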